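/- Let Ω be the x-periodic channel under h ∈ C^{0,1}(T) with 0 < h₀ ≤ h ≤ h₁ and M = ‖h_x‖_∞. Then for every p ∈ H¹(Ω) with zero mean, L⁻¹‖p‖_{L²(Ω)} ≤ C·‖∇p‖_{L²(Ω)}, where C = ((1+M)/(2π))·max(1, 2√(h₀h₁)/L)·√(h₁/h₀). -/

import Mathlib

open MeasureTheory Set

/-- The x-periodic channel `Ω = {(x,y) : x ∈ T, 0 < y < h(x)}`. -/
def ChannelOmega (L : ℝ) (h : ℝ → ℝ) : Set (ℝ × ℝ) :=
  {p : ℝ × ℝ | p.1 ∈ Set.Ioo 0 L ∧ p.2 ∈ Set.Ioo 0 (h p.1)}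

/-- Integration by parts of a complex `C¹` function against a real absolutely continuous one. -/
theorem AbsolutelyContinuousOnInterval.integral_complex_mul_deriv {a b : ℝ} {f : ℝ → ℝ}
    (hf : AbsolutelyContinuousOnInterval f a b) {e e' : ℝ → ℂ}
    (he : ∀ x, HasDerivAt e (e' x) x) (he' : Continuous e') :
    ∫ x in a..b, e x * ((deriv f x : ℝ) : ℂ) = e b * f b - e a * f a - ∫ x in a..b, e' x * (f x : ℂ) := by
  have hec : Continuous e := continuous_iff_continuousAt.2 fun x => (he x).continuousAt
  have hre : ∀ x, HasDerivAt (fun x => (e x).re) (e' x).re x := fun x =>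
    Complex.reCLM.hasFDerivAt.comp_hasDerivAt x (he x)
  have him : ∀ x, HasDerivAt (fun x => (e x).im) (e' x).im x := fun x =>
    Complex.imCLM.hasFDerivAt.comp_hasDerivAt x (he x)
  have ac : ∀ {u u' : ℝ → ℝ}, (∀ x, HasDerivAt u (u' x) x) → Continuous u' →
      ∫ x in a..b, u x * deriv f x = u b * f b - u a * f a - ∫ x in a..b, u' x * f x := by
    intro u u' hu hu'
    have hd : deriv u = u' := funext fun x => (hu x).deriv
    have hC : ContDiff ℝ 1 u := contDiff_one_iff_deriv.2
      ⟨fun x => (hu x).differentiableAt, by rwa [hd]⟩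
    rw [hC.contDiffOn.absolutelyContinuousOnInterval.integral_mul_deriv_eq_deriv_mul hf, hd]
  have hfi : IntervalIntegrable (fun x => (f x : ℂ)) volume a b :=
    (Complex.continuous_ofReal.comp_continuousOn hf.continuousOn).intervalIntegrable
  have hfd : IntervalIntegrable (fun x => ((deriv f x : ℝ) : ℂ)) volume a b :=
    ⟨hf.intervalIntegrable_deriv.1.ofReal, hf.intervalIntegrable_deriv.2.ofReal⟩
  have i1 := hfd.continuousOn_mul hec.continuousOn
  have i2 := hfi.continuousOn_mul he'.continuousOn
  have r1 := Complex.reCLM.intervalIntegral_comp_comm i1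
  have r2 := Complex.reCLM.intervalIntegral_comp_comm i2
  have m1 := Complex.imCLM.intervalIntegral_comp_comm i1
  have m2 := Complex.imCLM.intervalIntegral_comp_comm i2
  simp only [Complex.reCLM_apply, Complex.imCLM_apply, Complex.re_mul_ofReal,
    Complex.im_mul_ofReal] at r1 r2 m1 m2
  apply Complex.ext
  · simp only [Complex.sub_re, Complex.re_mul_ofReal]
    rw [← r1, ← r2]
    exact ac hre (Complex.continuous_re.comp he')
  · simp only [Complex.sub_im, Complex.im_mul_ofReal]
    rw [← m1, ← m2]
    exact ac him (Complex.continuous_im.comp he')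

/-- The Fourier coefficients of the derivative of an absolutely continuous function with equal
boundary values. -/
theorem AbsolutelyContinuousOnInterval.fourierCoeffOn_deriv {a b : ℝ} (hab : a < b) {f : ℝ → ℝ}
    (hf : AbsolutelyContinuousOnInterval f a b) (hfab : f a = f b) (n : ℤ) :
    fourierCoeffOn hab (fun x => ((deriv f x : ℝ) : ℂ)) n =
      2 * Real.pi * Complex.I * n / (b - a : ℝ) * fourierCoeffOn hab (fun x => (f x : ℂ)) n := by
  have hT : Fact (0 < b - a) := ⟨by linarith⟩
  rw [fourierCoeffOn_eq_integral, fourierCoeffOn_eq_integral]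
  simp only [smul_eq_mul]
  rw [hf.integral_complex_mul_deriv (fun x => hasDerivAt_fourier_neg (b - a) n x)
    (by simp only [fourier_coe_apply]; fun_prop)]
  have hba : ((b : ℝ) : AddCircle (b - a)) = (a : ℝ) := by
    simpa only [add_sub_cancel] using AddCircle.coe_add_period (b - a) a
  rw [hba, hfab]
  simp only [mul_assoc, intervalIntegral.integral_const_mul, sub_self, zero_sub]
  rw [← intervalIntegral.integral_const_mul, ← intervalIntegral.integral_neg]
  simp only [mul_smul_comm, ← intervalIntegral.integral_const_mul]
  congr 1
  congr 1
  ext x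
  ring

/-- **Wirtinger's inequality** for Lipschitz functions with equal boundary values and mean zero,
with any integrable majorant of the squared derivative. -/
theorem wirtinger_of_lipschitzOnWith {a b : ℝ} (hab : a < b) {f : ℝ → ℝ} {K : NNReal}
    (hf : LipschitzOnWith K f (Icc a b)) (hfab : f a = f b) (hmean : ∫ x in a..b, f x = 0)
    {φ : ℝ → ℝ} (hφ : IntervalIntegrable φ volume a b)
    (hle : ∀ᵐ x, x ∈ Ioo a b → (deriv f x) ^ 2 ≤ φ x) :
    ∫ x in a..b, (f x) ^ 2 ≤ ((b - a) / (2 * Real.pi)) ^ 2 * ∫ x in a..b, φ x := by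
  have hT : 0 < b - a := by linarith
  have hac : AbsolutelyContinuousOnInterval f a b :=
    LipschitzOnWith.absolutelyContinuousOnInterval (by rwa [uIcc_of_le hab.le])
  have hIoo : ∀ᵐ x ∂(volume.restrict (Ioc a b)), x ∈ Ioo a b := by
    rw [← restrict_Ioo_eq_restrict_Ioc]
    exact ae_restrict_mem measurableSet_Ioo
  have hbd : ∀ x ∈ Ioo a b, ‖deriv f x‖ ≤ K := fun x hx =>
    norm_deriv_le_of_lipschitzOn (Icc_mem_nhds hx.1 hx.2) hf
  have hf2 : MemLp (fun x => (f x : ℂ)) 2 (volume.restrict (Ioc a b)) := by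
    have hc : ContinuousOn (fun x => (f x : ℂ)) (Icc a b) :=
      Complex.continuous_ofReal.comp_continuousOn hf.continuousOn
    obtain ⟨C, hC⟩ := isCompact_Icc.exists_bound_of_continuousOn hc
    refine MemLp.of_bound ((hc.mono Ioc_subset_Icc_self).aestronglyMeasurable measurableSet_Ioc) C ?_
    filter_upwards [hIoo] with x hx using hC x (Ioo_subset_Icc_self hx)
  have hd2 : MemLp (fun x => ((deriv f x : ℝ) : ℂ)) 2 (volume.restrict (Ioc a b)) := by
    refine MemLp.of_bound
      (Complex.measurable_ofReal.comp (measurable_deriv f)).aestronglyMeasurable K ?_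
    filter_upwards [hIoo] with x hx using by simpa using hbd x hx
  have s1 := hasSum_sq_fourierCoeffOn hab hf2
  have s2 := (hasSum_sq_fourierCoeffOn hab hd2).mul_left (((b - a) / (2 * Real.pi)) ^ 2)
  have hterm : ∀ n : ℤ, ‖fourierCoeffOn hab (fun x => (f x : ℂ)) n‖ ^ 2 ≤
      ((b - a) / (2 * Real.pi)) ^ 2 * ‖fourierCoeffOn hab (fun x => ((deriv f x : ℝ) : ℂ)) n‖ ^ 2 := by
    intro n
    rcases eq_or_ne n 0 with rfl | hn
    · have h0 : fourierCoeffOn hab (fun x => (f x : ℂ)) 0 = 0 := by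
        rw [fourierCoeffOn_eq_integral]
        simp [intervalIntegral.integral_ofReal, hmean]
      rw [h0]
      simp only [norm_zero, ne_eq, OfNat.ofNat_ne_zero, not_false_eq_true, zero_pow]
      positivity
    · rw [hac.fourierCoeffOn_deriv hab hfab, norm_mul, ← mul_pow]
      have h1 : (1 : ℝ) ≤ |(n : ℝ)| := by
        have := Int.one_le_abs hn
        exact_mod_cast this
      have h2 : ‖(2 * Real.pi * Complex.I * n / (b - a : ℝ) : ℂ)‖ =
          2 * Real.pi * |(n : ℝ)| / (b - a) := by
        rw [norm_div, Complex.norm_real, Real.norm_of_nonneg hT.le]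
        simp [abs_of_pos Real.pi_pos]
      rw [h2]
      have h3 : (b - a) / (2 * Real.pi) * (2 * Real.pi * |(n : ℝ)| / (b - a) *
          ‖fourierCoeffOn hab (fun x => (f x : ℂ)) n‖) =
          |(n : ℝ)| * ‖fourierCoeffOn hab (fun x => (f x : ℂ)) n‖ := by
        have := Real.pi_pos.ne'
        field_simp
      rw [h3]
      gcongr
      exact le_mul_of_one_le_left (norm_nonneg _) h1
  have key := hasSum_le hterm s1 s2
  simp only [Complex.norm_real, Real.norm_eq_abs, sq_abs, smul_eq_mul] at key
  rw [mul_left_comm] at key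
  refine (le_of_mul_le_mul_left key (inv_pos.2 hT)).trans ?_
  gcongr
  rw [intervalIntegral.integral_of_le hab.le, intervalIntegral.integral_of_le hab.le]
  refine integral_mono_of_nonneg (Filter.Eventually.of_forall fun x => sq_nonneg _) hφ.1 ?_
  filter_upwards [hIoo, ae_restrict_of_ae hle] with x hx hx' using hx' hx

theorem intervalIntegral_comp_abs_symm {c : ℝ} (hc : 0 ≤ c) {F : ℝ → ℝ} (hF : Continuous F) :
    ∫ x in (-c)..c, F |x| = 2 * ∫ x in (0 : ℝ)..c, F x := by
  have hi : ∀ u v, IntervalIntegrable (fun x => F |x|) volume u v := fun u v =>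
    (hF.comp continuous_abs).intervalIntegrable u v
  rw [← intervalIntegral.integral_add_adjacent_intervals (hi (-c) 0) (hi 0 c)]
  have h1 : ∫ x in (0 : ℝ)..c, F |x| = ∫ x in (0 : ℝ)..c, F x :=
    intervalIntegral.integral_congr fun x hx => by
      rw [uIcc_of_le hc] at hx
      simp only [abs_of_nonneg hx.1]
  have h2 : ∫ x in (-c)..0, F |x| = ∫ x in (0 : ℝ)..c, F |x| := by
    have := intervalIntegral.integral_comp_neg (a := 0) (b := c) (fun x => F |x|)
    simp only [abs_neg, neg_zero] at this
    exact this.symm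
  rw [h2, h1, two_mul]

/-- The Poincaré inequality on `[0, 1]` with its sharp constant. -/
theorem poincare_unitInterval {f : ℝ → ℝ} (hf : ContDiff ℝ 1 f) :
    ∫ x in (0 : ℝ)..1, (f x - ∫ t in (0 : ℝ)..1, f t) ^ 2 ≤
      (1 / Real.pi) ^ 2 * ∫ x in (0 : ℝ)..1, (deriv f x) ^ 2 := by
  set c := ∫ t in (0 : ℝ)..1, f t with hc
  have hfc := hf.continuous
  have hdc : Continuous (deriv f) := hf.continuous_deriv le_rfl
  obtain ⟨K, hK⟩ := (hf.contDiffOn (s := Icc (-1) 1)).exists_lipschitzOnWith (by decide)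
    (convex_Icc _ _) isCompact_Icc
  have hlip : LipschitzOnWith K (fun x : ℝ => f |x| - c) (Icc (-1) 1) := by
    refine LipschitzOnWith.of_dist_le_mul fun x hx y hy => ?_
    rw [dist_sub_right]
    have m : ∀ z ∈ Icc (-1 : ℝ) 1, |z| ∈ Icc (-1 : ℝ) 1 := fun z hz =>
      ⟨by linarith [abs_nonneg z], abs_le.2 hz⟩
    refine (hK.dist_le_mul _ (m x hx) _ (m y hy)).trans ?_
    gcongr
    exact abs_abs_sub_abs_le_abs_sub x y
  have hder : ∀ x : ℝ, x ≠ 0 → (deriv (fun x : ℝ => f |x| - c) x) ^ 2 = (deriv f |x|) ^ 2 := by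
    intro x hx
    have hd := (hf.differentiable one_ne_zero |x|).hasDerivAt
    rcases hx.lt_or_gt with hx | hx
    · have h1 : HasDerivAt (fun x : ℝ => f |x| - c) _ x :=
        (hd.comp x (hasDerivAt_abs_neg hx)).sub_const c
      rw [h1.deriv]
      ring
    · have h1 : HasDerivAt (fun x : ℝ => f |x| - c) _ x :=
        (hd.comp x (hasDerivAt_abs_pos hx)).sub_const c
      rw [h1.deriv]
      ring
  have hw := wirtinger_of_lipschitzOnWith (a := -1) (b := 1) (by norm_num) hlip (by simp)
    (by
      rw [intervalIntegral_comp_abs_symm zero_le_one (F := fun x => f x - c) (by fun_prop),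
        intervalIntegral.integral_sub (hfc.intervalIntegrable _ _) (by simp)]
      simp [hc])
    (φ := fun x => (deriv f |x|) ^ 2)
    (((hdc.comp continuous_abs).pow 2).intervalIntegrable _ _)
    (by
      filter_upwards [Measure.ae_ne volume 0] with x hx _ using (hder x hx).le)
  rw [intervalIntegral_comp_abs_symm zero_le_one (F := fun x => (f x - c) ^ 2) (by fun_prop),
    intervalIntegral_comp_abs_symm zero_le_one (F := fun x => (deriv f x) ^ 2) (by fun_prop)] at hw
  have : ((1 - -1) / (2 * Real.pi)) = 1 / Real.pi := by
    have := Real.pi_pos.ne'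
    field_simp; norm_num
  rw [this] at hw
  linarith

theorem channelOmega_eq_regionBetween (L : ℝ) (h : ℝ → ℝ) :
    ChannelOmega L h = regionBetween 0 h (Ioo 0 L) := rfl

theorem measurableSet_channelOmega {L : ℝ} {h : ℝ → ℝ} (hh : Continuous h) :
    MeasurableSet (ChannelOmega L h) := by
  rw [channelOmega_eq_regionBetween]
  exact measurableSet_regionBetween measurable_zero hh.measurable measurableSet_Ioo

theorem Continuous.integrableOn_channelOmega {L h₁ : ℝ} {h : ℝ → ℝ} (hhigh : ∀ x, h x ≤ h₁)
    {g : ℝ × ℝ → ℝ} (hg : Continuous g) : IntegrableOn g (ChannelOmega L h) := by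
  refine (hg.continuousOn.integrableOn_compact
    ((isCompact_Icc (a := (0 : ℝ)) (b := L)).prod (isCompact_Icc (a := (0 : ℝ)) (b := h₁)))).mono_set
    fun z hz => ?_
  exact ⟨Ioo_subset_Icc_self hz.1, hz.2.1.le, hz.2.2.le.trans (hhigh _)⟩

/-- Integration over the channel after rescaling each vertical fibre to the unit interval. -/
theorem integral_channelOmega {L h₁ : ℝ} (hL : 0 ≤ L) {h : ℝ → ℝ} (hh : Continuous h)
    (hpos : ∀ x, 0 < h x) (hhigh : ∀ x, h x ≤ h₁) {g : ℝ × ℝ → ℝ} (hg : Continuous g) :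
    ∫ z in ChannelOmega L h, g z =
      ∫ x in (0 : ℝ)..L, h x * ∫ s in (0 : ℝ)..1, g (x, h x * s) := by
  have hm := measurableSet_channelOmega (L := L) hh
  have hi := (integrable_indicator_iff hm).2 (hg.integrableOn_channelOmega (L := L) hhigh)
  rw [← integral_indicator hm, Measure.volume_eq_prod, integral_prod _ hi,
    intervalIntegral.integral_of_le hL, integral_Ioc_eq_integral_Ioo,
    ← integral_indicator measurableSet_Ioo]
  congr 1
  ext x
  by_cases hx : x ∈ Ioo 0 L
  · rw [indicator_of_mem hx, ← smul_eq_mul,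
      intervalIntegral.smul_integral_comp_mul_left (fun y => g (x, y)), mul_zero, mul_one,
      intervalIntegral.integral_of_le (hpos x).le, integral_Ioc_eq_integral_Ioo,
      ← integral_indicator measurableSet_Ioo]
    congr 1
    ext y
    by_cases hy : y ∈ Ioo 0 (h x)
    · rw [indicator_of_mem hy, indicator_of_mem (show (x, y) ∈ ChannelOmega L h from ⟨hx, hy⟩)]
    · rw [indicator_of_notMem hy,
        indicator_of_notMem (show (x, y) ∉ ChannelOmega L h from fun hz => hy hz.2)]
  · rw [indicator_of_notMem hx]
    refine integral_eq_zero_of_ae (Filter.Eventually.of_forall fun y => ?_)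
    exact indicator_of_notMem (fun hz => hx hz.1) _

theorem Continuous.integral_fibre {h : ℝ → ℝ} (hh : Continuous h) {g : ℝ × ℝ → ℝ}
    (hg : Continuous g) : Continuous fun x => ∫ s in (0 : ℝ)..1, g (x, h x * s) :=
  intervalIntegral.continuous_parametric_intervalIntegral_of_continuous' (by fun_prop) _ _

/-- The decomposition of a second moment over `[0, 1]` into variance and squared bias. -/
theorem integral_sub_const_sq_unitInterval {F : ℝ → ℝ} (hF : Continuous F) (c : ℝ) :
    ∫ s in (0 : ℝ)..1, (F s - c) ^ 2 =
      (∫ s in (0 : ℝ)..1, (F s - ∫ t in (0 : ℝ)..1, F t) ^ 2) +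
        ((∫ t in (0 : ℝ)..1, F t) - c) ^ 2 := by
  have expand : ∀ d : ℝ, ∫ s in (0 : ℝ)..1, (F s - d) ^ 2 =
      (∫ s in (0 : ℝ)..1, (F s) ^ 2) - 2 * d * (∫ s in (0 : ℝ)..1, F s) + d ^ 2 := by
    intro d
    have i1 : IntervalIntegrable (fun s => (F s) ^ 2) volume 0 1 :=
      (hF.pow 2).intervalIntegrable _ _
    have i2 : IntervalIntegrable (fun s => 2 * d * F s) volume 0 1 :=
      (continuous_const.mul hF).intervalIntegrable _ _
    have : ∀ s, (F s - d) ^ 2 = (F s) ^ 2 - 2 * d * F s + d ^ 2 := fun s => by ring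
    simp only [this]
    rw [intervalIntegral.integral_add (i1.sub i2) (by simp), intervalIntegral.integral_sub i1 i2,
      intervalIntegral.integral_const_mul]
    simp
  rw [expand, expand]
  ring

theorem sq_integral_le_integral_sq_unitInterval {F : ℝ → ℝ} (hF : Continuous F) :
    (∫ s in (0 : ℝ)..1, F s) ^ 2 ≤ ∫ s in (0 : ℝ)..1, (F s) ^ 2 := by
  have h1 := integral_sub_const_sq_unitInterval hF 0
  simp only [sub_zero] at h1
  have h2 : 0 ≤ ∫ s in (0 : ℝ)..1, (F s - ∫ t in (0 : ℝ)..1, F t) ^ 2 :=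
    intervalIntegral.integral_nonneg zero_le_one fun s _ => sq_nonneg _
  linarith

/-- A `C¹` function composed with rescaled Lipschitz graphs is Lipschitz, uniformly in the scale. -/
theorem exists_lipschitzOnWith_comp_graph {h : ℝ → ℝ} {K : NNReal} (hlip : LipschitzWith K h)
    {p : ℝ × ℝ → ℝ} (hp : ContDiff ℝ 1 p) (a b : ℝ) :
    ∃ C : NNReal, ∀ s ∈ Icc (0 : ℝ) 1, LipschitzOnWith C (fun x => p (x, h x * s)) (Icc a b) := by
  obtain ⟨R, hR⟩ := isCompact_Icc.exists_bound_of_continuousOn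
    (hlip.continuous.continuousOn (s := Icc a b))
  obtain ⟨C, hC⟩ := (hp.contDiffOn (s := Icc a b ×ˢ Icc (-R) R)).exists_lipschitzOnWith
    (by decide) ((convex_Icc _ _).prod (convex_Icc _ _)) (isCompact_Icc.prod isCompact_Icc)
  refine ⟨C * max 1 K, fun s hs => ?_⟩
  refine hC.comp (g := p) (f := fun x => (x, h x * s)) (t := Icc a b ×ˢ Icc (-R) R)
    (LipschitzWith.lipschitzOnWith (LipschitzWith.id.prodMk ?_)) fun x hx => ⟨hx, ?_⟩
  · refine LipschitzWith.of_dist_le_mul fun x y => ?_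
    rw [Real.dist_eq, ← sub_mul, abs_mul, abs_of_nonneg hs.1, ← Real.dist_eq]
    exact (mul_le_of_le_one_right dist_nonneg hs.2).trans (hlip.dist_le_mul x y)
  · change h x * s ∈ Icc (-R) R
    rw [mem_Icc, ← abs_le, abs_mul, abs_of_nonneg hs.1]
    exact (mul_le_of_le_one_right (abs_nonneg _) hs.2).trans (hR x hx)

theorem exists_lipschitzOnWith_fibre_average {h : ℝ → ℝ} {K : NNReal} (hlip : LipschitzWith K h)
    {p : ℝ × ℝ → ℝ} (hp : ContDiff ℝ 1 p) (a b : ℝ) :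
    ∃ C : NNReal, LipschitzOnWith C (fun x => ∫ s in (0 : ℝ)..1, p (x, h x * s)) (Icc a b) := by
  obtain ⟨C, hC⟩ := exists_lipschitzOnWith_comp_graph hlip hp a b
  have hpc := hp.continuous
  refine ⟨C, LipschitzOnWith.of_dist_le_mul fun x hx y hy => ?_⟩
  rw [dist_eq_norm, ← intervalIntegral.integral_sub
    (Continuous.intervalIntegrable (by fun_prop) _ _)
    (Continuous.intervalIntegrable (by fun_prop) _ _)]
  refine (intervalIntegral.norm_integral_le_of_norm_le_const (C := C * dist x y)
    fun s hs => ?_).trans (by simp)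
  rw [uIoc_of_le zero_le_one] at hs
  rw [← dist_eq_norm]
  exact (hC s (Ioc_subset_Icc_self hs)).dist_le_mul x hx y hy

theorem hasDerivAt_fibre_average {h : ℝ → ℝ} {K : NNReal} (hlip : LipschitzWith K h)
    {p : ℝ × ℝ → ℝ} (hp : ContDiff ℝ 1 p) {x : ℝ} (hx : DifferentiableAt ℝ h x) :
    HasDerivAt (fun x => ∫ s in (0 : ℝ)..1, p (x, h x * s))
      (∫ s in (0 : ℝ)..1, (fderiv ℝ p (x, h x * s) (1, 0) +
        s * deriv h x * fderiv ℝ p (x, h x * s) (0, 1))) x := by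
  obtain ⟨C, hC⟩ := exists_lipschitzOnWith_comp_graph hlip hp (x - 1) (x + 1)
  have hpc := hp.continuous
  have hdc : Continuous (fderiv ℝ p) := hp.continuous_fderiv one_ne_zero
  refine (intervalIntegral.hasDerivAt_integral_of_dominated_loc_of_lip (μ := volume)
    (F := fun x s => p (x, h x * s)) (bound := fun _ => (C : ℝ))
    (Icc_mem_nhds (by linarith : x - 1 < x) (by linarith : x < x + 1))
    (Filter.Eventually.of_forall fun y => Continuous.aestronglyMeasurable (by fun_prop))
    (Continuous.intervalIntegrable (by fun_prop) _ _)
    (Continuous.aestronglyMeasurable (by fun_prop))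
    (Filter.Eventually.of_forall fun s hs => ?_) (by simp)
    (Filter.Eventually.of_forall fun s hs => ?_)).2
  · rw [uIoc_of_le zero_le_one] at hs
    simpa using hC s (Ioc_subset_Icc_self hs)
  · have h1 : HasDerivAt (fun y => (y, h y * s)) ((1 : ℝ), deriv h x * s) x :=
      (hasDerivAt_id x).prodMk (hx.hasDerivAt.mul_const s)
    have h2 := (hp.differentiable one_ne_zero (x, h x * s)).hasFDerivAt.comp_hasDerivAt x h1
    have h3 : ((1 : ℝ), deriv h x * s) = (1, 0) + (s * deriv h x) • ((0 : ℝ), (1 : ℝ)) := by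
      simp [mul_comm]
    rwa [h3, map_add, map_smul, smul_eq_mul] at h2

/-- The squared operator norm of the shear `(u, v) ↦ (u + t v, v)` is at most `(1 + M) ^ 2`. -/
theorem shear_sq_add_sq_le {t M : ℝ} (ht : |t| ≤ M) (u v : ℝ) :
    (u + t * v) ^ 2 + v ^ 2 ≤ (1 + M) ^ 2 * (u ^ 2 + v ^ 2) := by
  have h0 := abs_nonneg t
  have h1 : t * (2 * (u * v)) ≤ M * (u ^ 2 + v ^ 2) := by
    calc t * (2 * (u * v)) ≤ |t * (2 * (u * v))| := le_abs_self _
      _ = |t| * |2 * (u * v)| := abs_mul _ _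
      _ ≤ M * (u ^ 2 + v ^ 2) := by
        gcongr
        · exact h0.trans ht
        · exact abs_le.2 ⟨by nlinarith [sq_nonneg (u + v)], by nlinarith [sq_nonneg (u - v)]⟩
  have h2 : t ^ 2 ≤ M ^ 2 := sq_le_sq' (by linarith [neg_abs_le t]) (by linarith [le_abs_self t])
  have h3 : 0 ≤ M := h0.trans ht
  nlinarith [mul_le_mul_of_nonneg_right h2 (sq_nonneg v), mul_nonneg (sq_nonneg M) (sq_nonneg u),
    mul_nonneg h3 (add_nonneg (sq_nonneg u) (sq_nonneg v))]

/-- The squared derivative of the fibre average, bounded by averages of squared partials. -/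
theorem deriv_fibre_average_sq_le {h : ℝ → ℝ} {M : ℝ} (hM : 0 ≤ M)
    (hlip : LipschitzWith (Real.toNNReal M) h)
    {p : ℝ × ℝ → ℝ} (hp : ContDiff ℝ 1 p) {x : ℝ} (hx : DifferentiableAt ℝ h x) :
    (deriv (fun x => ∫ s in (0 : ℝ)..1, p (x, h x * s)) x) ^ 2 ≤
      (1 + M) ^ 2 * (∫ s in (0 : ℝ)..1, ((fderiv ℝ p (x, h x * s) (1, 0)) ^ 2 +
        (fderiv ℝ p (x, h x * s) (0, 1)) ^ 2)) -
      ∫ s in (0 : ℝ)..1, (fderiv ℝ p (x, h x * s) (0, 1)) ^ 2 := by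
  have hdc : Continuous (fderiv ℝ p) := hp.continuous_fderiv one_ne_zero
  have hh : |deriv h x| ≤ M := by
    simpa [Real.coe_toNNReal M hM] using norm_deriv_le_of_lipschitz (x₀ := x) hlip
  rw [(hasDerivAt_fibre_average hlip hp hx).deriv]
  refine (sq_integral_le_integral_sq_unitInterval (by fun_prop)).trans ?_
  rw [← intervalIntegral.integral_const_mul, ← intervalIntegral.integral_sub
    (Continuous.intervalIntegrable (by fun_prop) _ _)
    (Continuous.intervalIntegrable (by fun_prop) _ _)]
  refine intervalIntegral.integral_mono_on zero_le_one
    (Continuous.intervalIntegrable (by fun_prop) _ _)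
    (Continuous.intervalIntegrable (by fun_prop) _ _) fun s hs => ?_
  have hs' : |s * deriv h x| ≤ M := by
    rw [abs_mul, abs_of_nonneg hs.1]
    exact (mul_le_of_le_one_left (abs_nonneg _) hs.2).trans hh
  linarith [shear_sq_add_sq_le hs' (fderiv ℝ p (x, h x * s) (1, 0))
    (fderiv ℝ p (x, h x * s) (0, 1))]

/-- The Poincaré inequality on the fibre of the channel over `x`. -/
theorem poincare_fibre {h : ℝ → ℝ} {p : ℝ × ℝ → ℝ} (hp : ContDiff ℝ 1 p) (x : ℝ) :
    ∫ s in (0 : ℝ)..1, (p (x, h x * s) - ∫ t in (0 : ℝ)..1, p (x, h x * t)) ^ 2 ≤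
      (1 / Real.pi) ^ 2 * ((h x) ^ 2 *
        ∫ s in (0 : ℝ)..1, (fderiv ℝ p (x, h x * s) (0, 1)) ^ 2) := by
  have hder : ∀ s, deriv (fun s => p (x, h x * s)) s =
      h x * fderiv ℝ p (x, h x * s) (0, 1) := by
    intro s
    have h1 : HasDerivAt (fun s => (x, h x * s)) ((0 : ℝ), h x * 1) s :=
      (hasDerivAt_const s x).prodMk ((hasDerivAt_id s).const_mul (h x))
    have h2 := (hp.differentiable one_ne_zero (x, h x * s)).hasFDerivAt.comp_hasDerivAt s h1
    have h3 : ((0 : ℝ), h x * 1) = h x • ((0 : ℝ), (1 : ℝ)) := by simp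
    rw [h3, map_smul, smul_eq_mul] at h2
    exact h2.deriv
  have := poincare_unitInterval (f := fun s => p (x, h x * s)) (hp.comp (by fun_prop))
  simpa only [hder, mul_pow, intervalIntegral.integral_const_mul] using this

/-- The second moment of a mean-zero function does not exceed that about any other point. -/
theorem setIntegral_sq_le_setIntegral_sub_const_sq {α : Type*} [MeasurableSpace α] {μ : Measure α}
    {s : Set α} {f : α → ℝ} (hf : IntegrableOn f s μ) (hf2 : IntegrableOn (fun z => f z ^ 2) s μ)
    (hs : μ s ≠ ⊤) (hmean : ∫ z in s, f z ∂μ = 0) (c : ℝ) :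
    ∫ z in s, f z ^ 2 ∂μ ≤ ∫ z in s, (f z - c) ^ 2 ∂μ := by
  have e : ∀ z, (f z - c) ^ 2 = f z ^ 2 - 2 * c * f z + c ^ 2 := fun z => by ring
  have i1 : Integrable (fun z => 2 * c * f z) (μ.restrict s) := hf.const_mul _
  have i2 : Integrable (fun _ => c ^ 2) (μ.restrict s) := integrableOn_const hs
  simp only [e]
  have i3 : Integrable (fun z => f z ^ 2 - 2 * c * f z) (μ.restrict s) := hf2.sub i1
  rw [integral_add i3 i2, integral_sub hf2 i1, integral_const_mul, hmean]
  have : 0 ≤ ∫ _ in s, c ^ 2 ∂μ := integral_nonneg fun _ => sq_nonneg c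
  linarith

/-- The weights of the two one-dimensional inequalities, compared with the channel constant. -/
theorem channel_weight_le {L h₀ h₁ M y P G : ℝ} (hL : 0 < L) (hh₀ : 0 < h₀) (hM : 0 ≤ M)
    (hy₀ : h₀ ≤ y) (hy₁ : y ≤ h₁) (hP : 0 ≤ P) (hPG : P ≤ G) :
    h₁ * ((1 / Real.pi) ^ 2 * (y ^ 2 * P)) +
        h₁ * ((L / (2 * Real.pi)) ^ 2 * ((1 + M) ^ 2 * G - P)) ≤
      (L * ((1 + M) / (2 * Real.pi) * max 1 (2 * Real.sqrt (h₀ * h₁) / L) *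
          Real.sqrt (h₁ / h₀))) ^ 2 * (y * G) := by
  have hy : 0 < y := hh₀.trans_le hy₀
  have hh₁ : 0 < h₁ := hy.trans_le hy₁
  have hG : 0 ≤ G := hP.trans hPG
  have hπ := Real.pi_pos
  set D := max 1 (2 * Real.sqrt (h₀ * h₁) / L) with hD
  have hD1 : 1 ≤ D ^ 2 := one_le_pow₀ (le_max_left _ _)
  have hD2 : 4 * (h₀ * h₁) / L ^ 2 ≤ D ^ 2 := by
    have : (2 * Real.sqrt (h₀ * h₁) / L) ^ 2 ≤ D ^ 2 :=
      pow_le_pow_left₀ (by positivity) (le_max_right _ _) 2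
    rw [div_pow, mul_pow, Real.sq_sqrt (by positivity)] at this
    linarith
  have hr1 : 1 ≤ y / h₀ := (one_le_div hh₀).2 hy₀
  have hE1 : 1 ≤ D ^ 2 * (y / h₀) := one_le_mul_of_one_le_of_one_le hD1 hr1
  have hE2 : 4 * y ^ 2 / L ^ 2 ≤ D ^ 2 * (y / h₀) := by
    calc 4 * y ^ 2 / L ^ 2 ≤ 4 * (h₁ * y) / L ^ 2 := by
          rw [sq]; gcongr
      _ = 4 * (h₀ * h₁) / L ^ 2 * (y / h₀) := by field_simp
      _ ≤ D ^ 2 * (y / h₀) := by gcongr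
  have hrhs : (L * ((1 + M) / (2 * Real.pi) * D * Real.sqrt (h₁ / h₀))) ^ 2 * (y * G) =
      h₁ * (L / (2 * Real.pi)) ^ 2 * (D ^ 2 * (y / h₀) * ((1 + M) ^ 2 * G)) := by
    simp only [mul_pow, div_pow, Real.sq_sqrt (show 0 ≤ h₁ / h₀ by positivity)]
    field_simp
  have hlhs : h₁ * ((1 / Real.pi) ^ 2 * (y ^ 2 * P)) +
        h₁ * ((L / (2 * Real.pi)) ^ 2 * ((1 + M) ^ 2 * G - P)) =
      h₁ * (L / (2 * Real.pi)) ^ 2 * (4 * y ^ 2 / L ^ 2 * P + ((1 + M) ^ 2 * G - P)) := by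
    field_simp
    ring
  rw [hrhs, hlhs]
  refine mul_le_mul_of_nonneg_left ?_ (by positivity)
  have hPM : P ≤ (1 + M) ^ 2 * G :=
    hPG.trans (le_mul_of_one_le_left hG (one_le_pow₀ (by linarith)))
  nlinarith [mul_le_mul_of_nonneg_right hE2 hP, mul_le_mul_of_nonneg_left hPM (sub_nonneg.2 hE1)]

/-- Theorem B.1 (Poincaré–Friedrichs on `H¹_#(Ω)` with explicit constant):
for a periodic Lipschitz `h` with `0 < h₀ ≤ h ≤ h₁` and Lipschitz constant
(`= ‖h_x‖_∞`) at most `M`, every mean-zero `p ∈ H¹(Ω)` (modeled by `C¹`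
functions, `L`-periodic in `x`) satisfies `L⁻¹‖p‖₀ ≤ C ‖∇p‖₀` with
`C = ((1+M)/(2π)) max(1, 2√(h₀h₁)/L) √(h₁/h₀)`. -/
theorem poincare_friedrichs_mean_zero (L h₀ h₁ M : ℝ)
    (hL : 0 < L) (hh₀ : 0 < h₀) (hM : 0 ≤ M)
    (h : ℝ → ℝ) (hlip : LipschitzWith (Real.toNNReal M) h)
    (hperh : ∀ x, h (x + L) = h x)
    (hlow : ∀ x, h₀ ≤ h x) (hhigh : ∀ x, h x ≤ h₁)
    (p : ℝ × ℝ → ℝ) (hp : ContDiff ℝ 1 p)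
    (hper : ∀ x y, p (x + L, y) = p (x, y))
    (hmean : ∫ z in ChannelOmega L h, p z = 0) :
    L⁻¹ * Real.sqrt (∫ z in ChannelOmega L h, (p z) ^ 2)
      ≤ ((1 + M) / (2 * Real.pi) * max 1 (2 * Real.sqrt (h₀ * h₁) / L) *
          Real.sqrt (h₁ / h₀)) *
        Real.sqrt (∫ z in ChannelOmega L h,
          (fderiv ℝ p z (1, 0)) ^ 2 + (fderiv ℝ p z (0, 1)) ^ 2) := by
  have hhc : Continuous h := hlip.continuous
  have hpc : Continuous p := hp.continuous
  have hdc : Continuous (fderiv ℝ p) := hp.continuous_fderiv one_ne_zero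
  have hpos : ∀ x, 0 < h x := fun x => hh₀.trans_le (hlow x)
  have hh₁ : 0 < h₁ := (hpos 0).trans_le (hhigh 0)
  set C := (1 + M) / (2 * Real.pi) * max 1 (2 * Real.sqrt (h₀ * h₁) / L) *
    Real.sqrt (h₁ / h₀) with hC
  set m : ℝ → ℝ := fun x => ∫ s in (0 : ℝ)..1, p (x, h x * s) with hm
  set P : ℝ → ℝ := fun x => ∫ s in (0 : ℝ)..1, (fderiv ℝ p (x, h x * s) (0, 1)) ^ 2 with hP
  set G : ℝ → ℝ := fun x => ∫ s in (0 : ℝ)..1, ((fderiv ℝ p (x, h x * s) (1, 0)) ^ 2 +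
    (fderiv ℝ p (x, h x * s) (0, 1)) ^ 2) with hG
  have hmc : Continuous m := hhc.integral_fibre hpc
  have hPc : Continuous P := hhc.integral_fibre (g := fun z => (fderiv ℝ p z (0, 1)) ^ 2)
    (by fun_prop)
  have hGc : Continuous G := hhc.integral_fibre
    (g := fun z => (fderiv ℝ p z (1, 0)) ^ 2 + (fderiv ℝ p z (0, 1)) ^ 2) (by fun_prop)
  have hP0 : ∀ x, 0 ≤ P x := fun x =>
    intervalIntegral.integral_nonneg zero_le_one fun s _ => sq_nonneg _
  have hPG : ∀ x, P x ≤ G x := fun x => intervalIntegral.integral_mono_on zero_le_one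
    (Continuous.intervalIntegrable (by fun_prop) _ _)
    (Continuous.intervalIntegrable (by fun_prop) _ _) fun s _ => by
      linarith [sq_nonneg (fderiv ℝ p (x, h x * s) (1, 0))]
  set c := L⁻¹ * ∫ x in (0 : ℝ)..L, m x with hc
  have hwirt : ∫ x in (0 : ℝ)..L, (m x - c) ^ 2 ≤
      (L / (2 * Real.pi)) ^ 2 * ∫ x in (0 : ℝ)..L, ((1 + M) ^ 2 * G x - P x) := by
    obtain ⟨K, hK⟩ := exists_lipschitzOnWith_fibre_average hlip hp 0 L
    have hmper : m 0 = m L := by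
      have h1 : h L = h 0 := by simpa using hperh 0
      have h2 : ∀ y, p (L, y) = p (0, y) := fun y => by simpa using hper 0 y
      simp only [hm, h1, h2]
    have := wirtinger_of_lipschitzOnWith hL (f := fun x => m x - c) (K := K)
      (LipschitzOnWith.of_dist_le_mul fun x hx y hy => by
        rw [dist_sub_right]; exact hK.dist_le_mul x hx y hy)
      (by rw [hmper])
      (by
        rw [intervalIntegral.integral_sub (hmc.intervalIntegrable _ _) (by simp)]
        simp only [intervalIntegral.integral_const, sub_zero, smul_eq_mul, hc]
        rw [mul_inv_cancel_left₀ hL.ne', sub_self])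
      (φ := fun x => (1 + M) ^ 2 * G x - P x)
      (Continuous.intervalIntegrable (by fun_prop) _ _)
      (by
        filter_upwards [hlip.ae_differentiableAt] with x hx _
        rw [deriv_sub_const]
        exact deriv_fibre_average_sq_le hM hlip hp hx)
    simpa only [sub_zero] using this
  have hfin : volume (ChannelOmega L h) ≠ ⊤ := by
    have := (continuous_const (y := (1 : ℝ)) (X := ℝ × ℝ)).integrableOn_channelOmega
      (L := L) hhigh
    simpa [integrableOn_const_iff, lt_top_iff_ne_top] using this
  have hmain : ∫ z in ChannelOmega L h, (p z) ^ 2 ≤ (L * C) ^ 2 *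
      ∫ z in ChannelOmega L h, ((fderiv ℝ p z (1, 0)) ^ 2 + (fderiv ℝ p z (0, 1)) ^ 2) := by
    rw [integral_channelOmega hL.le hhc hpos hhigh
      (g := fun z => (fderiv ℝ p z (1, 0)) ^ 2 + (fderiv ℝ p z (0, 1)) ^ 2) (by fun_prop)]
    calc ∫ z in ChannelOmega L h, (p z) ^ 2
        ≤ ∫ z in ChannelOmega L h, (p z - c) ^ 2 :=
          setIntegral_sq_le_setIntegral_sub_const_sq (hpc.integrableOn_channelOmega hhigh)
            ((hpc.pow 2).integrableOn_channelOmega hhigh) hfin hmean c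
      _ = ∫ x in (0 : ℝ)..L, h x * ∫ s in (0 : ℝ)..1, (p (x, h x * s) - c) ^ 2 :=
          integral_channelOmega hL.le hhc hpos hhigh (g := fun z => (p z - c) ^ 2) (by fun_prop)
      _ ≤ ∫ x in (0 : ℝ)..L,
            (h₁ * ((1 / Real.pi) ^ 2 * ((h x) ^ 2 * P x)) + h₁ * (m x - c) ^ 2) := by
          refine intervalIntegral.integral_mono_on hL.le
            ((hhc.mul (hhc.integral_fibre (g := fun z => (p z - c) ^ 2)
              (by fun_prop))).intervalIntegrable _ _)
            (Continuous.intervalIntegrable (by fun_prop) _ _) fun x _ => ?_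
          rw [← mul_add, integral_sub_const_sq_unitInterval (F := fun s => p (x, h x * s))
            (by fun_prop) c]
          have hfib := poincare_fibre (h := h) hp x
          exact mul_le_mul (hhigh x) (add_le_add hfib le_rfl)
            (add_nonneg (intervalIntegral.integral_nonneg zero_le_one fun s _ => sq_nonneg _)
              (sq_nonneg _)) hh₁.le
      _ ≤ ∫ x in (0 : ℝ)..L, (h₁ * ((1 / Real.pi) ^ 2 * ((h x) ^ 2 * P x)) +
            h₁ * ((L / (2 * Real.pi)) ^ 2 * ((1 + M) ^ 2 * G x - P x))) := by
          rw [intervalIntegral.integral_add (Continuous.intervalIntegrable (by fun_prop) _ _)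
              (Continuous.intervalIntegrable (by fun_prop) _ _),
            intervalIntegral.integral_add (Continuous.intervalIntegrable (by fun_prop) _ _)
              (Continuous.intervalIntegrable (by fun_prop) _ _)]
          simp only [intervalIntegral.integral_const_mul] at hwirt ⊢
          gcongr
      _ ≤ ∫ x in (0 : ℝ)..L, (L * C) ^ 2 * (h x * G x) :=
          intervalIntegral.integral_mono_on hL.le
            (Continuous.intervalIntegrable (by fun_prop) _ _)
            (Continuous.intervalIntegrable (by fun_prop) _ _) fun x _ =>
            channel_weight_le hL hh₀ hM (hlow x) (hhigh x) (hP0 x) (hPG x)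
      _ = (L * C) ^ 2 * ∫ x in (0 : ℝ)..L, h x * G x := intervalIntegral.integral_const_mul _ _
  have hC0 : 0 ≤ L * C := by positivity
  rw [inv_mul_le_iff₀ hL, ← mul_assoc]
  calc Real.sqrt (∫ z in ChannelOmega L h, (p z) ^ 2) ≤ _ := Real.sqrt_le_sqrt hmain
    _ = _ := by rw [Real.sqrt_mul (sq_nonneg _), Real.sqrt_sq hC0]
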